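/- Let d, r be positive integers with 2r < d − 1, and let u*₁, …, u*_{d−1} be an orthonormal basis of ℝ^{d−1}. Let 𝓗 = {W ∈ ℝ^{r×d} : every row of W has ℓ₂-norm at most 1} and let 𝓗₀ be the set of W ∈ ℝ^{r×d} such that for some O ∈ ℝ^{r×r} with OᵀO = I_r, the i-th row of W equals (0, u_i) for every i, where u_i = Σ_{j=1}^r O_{ij} u*_j ∈ ℝ^{d−1} (i.e., each row has first coordinate 0 and the rows' remaining coordinates form an orthonormal rotation of u*₁, …, u*_r). Then for every ρ ∈ (0, 1/2), N_𝓗(ρ) ≥ binom(d − 1 − r, r) · N_{𝓗₀}(ρ), where covers are taken with respect to the Frobenius distance on ℝ^{r×d}. -/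

import Mathlib

open Matrix

/-- Frobenius distance between two real matrices. -/
noncomputable def frobDist {m n : ℕ} (A B : Matrix (Fin m) (Fin n) ℝ) : ℝ :=
  Real.sqrt (∑ i, ∑ j, (A i j - B i j)^2)

/-- Minimal cardinality of a `ρ`-cover of `A` w.r.t. the Frobenius distance,
`∞` if no finite cover exists. -/
noncomputable def coverNum {m n : ℕ} (A : Set (Matrix (Fin m) (Fin n) ℝ)) (ρ : ℝ) : ℕ∞ :=
  sInf ((fun C : Finset (Matrix (Fin m) (Fin n) ℝ) => (C.card : ℕ∞)) ''
    {C | ∀ W ∈ A, ∃ W' ∈ C, frobDist W W' ≤ ρ})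

theorem frobDist_eq_dist {m n : ℕ} (A B : Matrix (Fin m) (Fin n) ℝ) :
    frobDist A B = dist (WithLp.toLp 2 fun p : Fin m × Fin n => A p.1 p.2)
      (WithLp.toLp 2 fun p : Fin m × Fin n => B p.1 p.2) := by
  simp [frobDist, EuclideanSpace.dist_eq, Real.dist_eq, Fintype.sum_prod_type]

theorem frobDist_triangle_right {m n : ℕ} (A B C : Matrix (Fin m) (Fin n) ℝ) :
    frobDist A B ≤ frobDist A C + frobDist B C := by
  simp only [frobDist_eq_dist]
  exact dist_triangle_right _ _ _

theorem frobDist_eq_sqrt_trace {m n : ℕ} (A B : Matrix (Fin m) (Fin n) ℝ) :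
    frobDist A B = Real.sqrt (((A - B) * (A - B)ᵀ).trace) := by
  simp [frobDist, Matrix.trace, Matrix.mul_apply, pow_two]

theorem frobDist_mul_right {m n : ℕ} (A B : Matrix (Fin m) (Fin n) ℝ)
    {Q : Matrix (Fin n) (Fin n) ℝ} (hQ : Q * Qᵀ = 1) :
    frobDist (A * Q) (B * Q) = frobDist A B := by
  rw [frobDist_eq_sqrt_trace, frobDist_eq_sqrt_trace, ← Matrix.sub_mul, Matrix.transpose_mul,
    Matrix.mul_assoc, ← Matrix.mul_assoc Q, hQ, Matrix.one_mul]

/-- The Frobenius norm dominates the norm of the image of any unit vector. -/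
theorem sqrt_sum_sq_mulVec_le_frobDist {m n : ℕ} (A B : Matrix (Fin m) (Fin n) ℝ)
    {v : Fin n → ℝ} (hv : ∑ j, v j ^ 2 = 1) :
    Real.sqrt (∑ i, ((A - B) *ᵥ v) i ^ 2) ≤ frobDist A B := by
  refine Real.sqrt_le_sqrt (Finset.sum_le_sum fun i _ => ?_)
  have h := Finset.sum_mul_sq_le_sq_mul_sq Finset.univ (fun j => A i j - B i j) v
  rw [hv, mul_one] at h
  simpa [Matrix.mulVec, dotProduct] using h

/-- Matrices whose rows are an orthonormal rotation of the rows `U (g 0), U (g 1), …`. -/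
def rotatedRows {r n : ℕ} (U : Matrix (Fin n) (Fin n) ℝ) (g : Fin r → Fin n) :
    Set (Matrix (Fin r) (Fin n) ℝ) :=
  {W | ∃ O : Matrix (Fin r) (Fin r) ℝ, Oᵀ * O = 1 ∧ W = O * U.submatrix g id}

theorem sum_sq_row_of_mem_rotatedRows {r n : ℕ} {U : Matrix (Fin n) (Fin n) ℝ}
    (hU : U * Uᵀ = 1) {g : Fin r → Fin n} (hg : Function.Injective g)
    {W : Matrix (Fin r) (Fin n) ℝ} (hW : W ∈ rotatedRows U g) (i : Fin r) :
    ∑ j, W i j ^ 2 = 1 := by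
  obtain ⟨O, hO, rfl⟩ := hW
  have h : (O * U.submatrix g id) * (O * U.submatrix g id)ᵀ = 1 := by
    rw [Matrix.transpose_mul, Matrix.mul_assoc, ← Matrix.mul_assoc (U.submatrix g id),
      Matrix.transpose_submatrix, ← Matrix.submatrix_mul _ _ g id g Function.bijective_id, hU,
      Matrix.submatrix_one _ hg, Matrix.one_mul]
    exact mul_eq_one_comm.mp hO
  have h' := congrFun (congrFun h i) i
  rw [Matrix.mul_apply, Matrix.one_apply_eq] at h'
  simpa only [pow_two, Matrix.transpose_apply] using h'

theorem one_le_frobDist_of_mem_rotatedRows {r n : ℕ} {U : Matrix (Fin n) (Fin n) ℝ}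
    (hU : U * Uᵀ = 1) {g h : Fin r → Fin n} (hg : Function.Injective g) {k : Fin r}
    (hk : ∀ l, h l ≠ g k) {A B : Matrix (Fin r) (Fin n) ℝ}
    (hA : A ∈ rotatedRows U g) (hB : B ∈ rotatedRows U h) : 1 ≤ frobDist A B := by
  obtain ⟨O, hO, rfl⟩ := hA
  obtain ⟨O', -, rfl⟩ := hB
  have hUU : ∀ a b, U a ⬝ᵥ U b = if a = b then 1 else 0 := fun a b => by
    have := congrFun (congrFun hU a) b
    rwa [Matrix.mul_apply, Matrix.one_apply] at this
  have hv : ∑ j, U (g k) j ^ 2 = 1 := by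
    simpa [dotProduct, pow_two] using hUU (g k) (g k)
  have hgv : U.submatrix g id *ᵥ U (g k) = Pi.single k 1 := by
    ext l
    refine (hUU (g l) (g k)).trans ?_
    simp [Pi.single_apply, hg.eq_iff]
  have hhv : U.submatrix h id *ᵥ U (g k) = 0 := by
    ext l
    exact (hUU (h l) (g k)).trans (if_neg (hk l))
  refine le_trans (le_of_eq ?_) (sqrt_sum_sq_mulVec_le_frobDist _ _ hv)
  have hOk := congrFun (congrFun hO k) k
  rw [Matrix.mul_apply, Matrix.one_apply_eq] at hOk
  rw [Matrix.sub_mulVec, ← Matrix.mulVec_mulVec, ← Matrix.mulVec_mulVec, hgv, hhv]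
  symm
  simpa [pow_two] using hOk

theorem coverNum_le_card {m n : ℕ} {A : Set (Matrix (Fin m) (Fin n) ℝ)} {ρ : ℝ}
    {C : Finset (Matrix (Fin m) (Fin n) ℝ)} (hC : ∀ W ∈ A, ∃ W' ∈ C, frobDist W W' ≤ ρ) :
    coverNum A ρ ≤ C.card :=
  sInf_le ⟨C, hC, rfl⟩

/-- Rotating the columns shows that covering numbers of `rotatedRows U g` do not depend on `g`. -/
theorem coverNum_rotatedRows_le {r n : ℕ} {U : Matrix (Fin n) (Fin n) ℝ}
    (hU : U * Uᵀ = 1) (f g : Fin r ↪ Fin n) {ρ : ℝ} :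
    coverNum (rotatedRows U f) ρ ≤ coverNum (rotatedRows U g) ρ := by
  classical
  obtain ⟨π, hπ⟩ : ∃ π : Equiv.Perm (Fin n), ∀ i, π (f i) = g i := by
    have := Equiv.Perm.isMultiplyPretransitive (Fin n) r
    obtain ⟨π, hπ⟩ := this.exists_smul_eq f g
    exact ⟨π, fun i => DFunLike.congr_fun hπ i⟩
  have hU' : Uᵀ * U = 1 := mul_eq_one_comm.mp hU
  set Q : Matrix (Fin n) (Fin n) ℝ := Uᵀ * U.submatrix π id with hQdef
  have hQ : Q * Qᵀ = 1 := by
    rw [hQdef, Matrix.transpose_mul, Matrix.mul_assoc, ← Matrix.mul_assoc (U.submatrix π id),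
      Matrix.transpose_submatrix, ← Matrix.submatrix_mul _ _ π id π Function.bijective_id, hU,
      Matrix.submatrix_one _ π.injective, Matrix.one_mul, Matrix.transpose_transpose, hU']
  have hfQ : U.submatrix f id * Q = U.submatrix g id := by
    have h : U.submatrix f id * Uᵀ = (1 : Matrix (Fin n) (Fin n) ℝ).submatrix f id := by
      rw [← hU, Matrix.submatrix_mul _ _ f id id Function.bijective_id, Matrix.submatrix_id_id]
    rw [hQdef, ← Matrix.mul_assoc, h]
    ext i j
    simp [Matrix.mul_apply, Matrix.one_apply, hπ]
  refine le_sInf ?_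
  rintro _ ⟨C, hC, rfl⟩
  refine (coverNum_le_card (C := C.image (· * Qᵀ)) ?_).trans
    (Nat.cast_le.mpr Finset.card_image_le)
  rintro _ ⟨O, hO, rfl⟩
  obtain ⟨W', hW', hd⟩ := hC (O * U.submatrix g id) ⟨O, hO, rfl⟩
  refine ⟨W' * Qᵀ, Finset.mem_image_of_mem _ hW', ?_⟩
  rwa [← frobDist_mul_right _ _ hQ, Matrix.mul_assoc W', mul_eq_one_comm.mp hQ, Matrix.mul_one,
    Matrix.mul_assoc, hfQ]

/-- The families `rotatedRows U g` with distinct ranges are `1`-separated, so no ball of radius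
`ρ < 1 / 2` meets two of them. -/
theorem choose_mul_coverNum_rotatedRows_le {r n : ℕ} {U : Matrix (Fin n) (Fin n) ℝ}
    (hU : U * Uᵀ = 1) (f : Fin r ↪ Fin n) {ρ : ℝ} (hρ : ρ < 1 / 2) :
    (n.choose r : ℕ∞) * coverNum (rotatedRows U f) ρ ≤
      coverNum {W : Matrix (Fin r) (Fin n) ℝ | ∀ i, ∑ j, (W i j)^2 ≤ 1} ρ := by
  classical
  refine le_sInf ?_
  rintro _ ⟨C, hC, rfl⟩
  set I := {S : Finset (Fin n) // S.card = r}
  let g : I → Fin r ↪ Fin n := fun S => (S.1.orderEmbOfFin S.2).toEmbedding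
  let D : I → Finset (Matrix (Fin r) (Fin n) ℝ) := fun S =>
    C.filter fun W' => ∃ W ∈ rotatedRows U (g S), frobDist W W' ≤ ρ
  have hD : ∀ S, coverNum (rotatedRows U f) ρ ≤ (D S).card := fun S => by
    refine (coverNum_rotatedRows_le hU f (g S)).trans (coverNum_le_card fun W hW => ?_)
    obtain ⟨W', hW', hd⟩ := hC W fun i =>
      (sum_sq_row_of_mem_rotatedRows hU (g S).injective hW i).le
    exact ⟨W', Finset.mem_filter.mpr ⟨hW', W, hW, hd⟩, hd⟩
  have hdisj : ∀ S T : I, S ≠ T → Disjoint (D S) (D T) := fun S T hST => by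
    refine Finset.disjoint_left.mpr fun W' hS hT => ?_
    obtain ⟨-, A, hA, hAd⟩ := Finset.mem_filter.mp hS
    obtain ⟨-, B, hB, hBd⟩ := Finset.mem_filter.mp hT
    obtain ⟨a, haS, haT⟩ : ∃ a ∈ S.1, a ∉ T.1 := by
      by_contra! h
      exact hST (Subtype.ext (Finset.eq_of_subset_of_card_le h (T.2.trans S.2.symm).le))
    obtain ⟨k, hk⟩ : ∃ k, g S k = a := by
      have : a ∈ Set.range (S.1.orderEmbOfFin S.2) := by
        rwa [Finset.range_orderEmbOfFin]
      exact this
    have h1 := one_le_frobDist_of_mem_rotatedRows hU (g S).injective (k := k) (h := g T)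
      (fun l hl => haT (hk ▸ hl ▸ Finset.orderEmbOfFin_mem T.1 T.2 l)) hA hB
    linarith [frobDist_triangle_right A B W']
  calc (n.choose r : ℕ∞) * coverNum (rotatedRows U f) ρ
      = ∑ _S : I, coverNum (rotatedRows U f) ρ := by
        simp [I, Finset.sum_const, Fintype.card_finset_len]
    _ ≤ ∑ S : I, ((D S).card : ℕ∞) := Finset.sum_le_sum fun S _ => hD S
    _ = ((Finset.univ.biUnion D).card : ℕ∞) := by
        rw [Finset.card_biUnion fun S _ T _ h => hdisj S T h]
        push_cast
        rfl
    _ ≤ C.card := Nat.cast_le.mpr <| Finset.card_le_card <|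
        Finset.biUnion_subset.mpr fun S _ => Finset.filter_subset _ _

/-- Statement 14, with the ambient dimension written as `d = dm1 + 1` so that
vectors in `ℝ^{d-1}` are indexed by `Fin dm1` and the columns of the weight
matrices split as column `0` plus columns `Fin.succ t` for `t : Fin dm1`. -/
theorem stmt_14 {dm1 r : ℕ} (hr0 : 0 < r) (hrd : 2 * r < dm1)
    (ustar : Fin dm1 → (Fin dm1 → ℝ))
    (hustar : ∀ i j : Fin dm1, ∑ t, ustar i t * ustar j t = if i = j then (1:ℝ) else 0) :
    ∀ ρ ∈ Set.Ioo (0:ℝ) (1/2),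
      (Nat.choose (dm1 - r) r : ℕ∞) *
        coverNum {W : Matrix (Fin r) (Fin (dm1+1)) ℝ |
          ∃ O : Matrix (Fin r) (Fin r) ℝ, Oᵀ * O = 1 ∧
            ∀ i : Fin r, W i 0 = 0 ∧
              ∀ t : Fin dm1, W i t.succ =
                ∑ j : Fin r, O i j * ustar (Fin.castLE (by omega) j) t} ρ ≤
      coverNum {W : Matrix (Fin r) (Fin (dm1+1)) ℝ | ∀ i, ∑ j, (W i j)^2 ≤ 1} ρ := by
  intro ρ hρ
  let U : Matrix (Fin (dm1 + 1)) (Fin (dm1 + 1)) ℝ :=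
    Matrix.of (Fin.cons (Pi.single 0 1) fun k => Fin.cons 0 (ustar k))
  have hU : U * Uᵀ = 1 := by
    ext a b
    refine Fin.cases ?_ (fun k => ?_) a <;> refine Fin.cases ?_ (fun l => ?_) b <;>
      simp [U, Matrix.mul_apply, Fin.sum_univ_succ, Matrix.one_apply, hustar, Fin.succ_ne_zero,
        (Fin.succ_ne_zero _).symm]
  let f : Fin r ↪ Fin (dm1 + 1) :=
    (Fin.castLEEmb (by omega : r ≤ dm1)).trans (Fin.succEmb dm1)
  have hset : {W : Matrix (Fin r) (Fin (dm1+1)) ℝ |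
      ∃ O : Matrix (Fin r) (Fin r) ℝ, Oᵀ * O = 1 ∧
        ∀ i : Fin r, W i 0 = 0 ∧
          ∀ t : Fin dm1, W i t.succ =
            ∑ j : Fin r, O i j * ustar (Fin.castLE (by omega) j) t} = rotatedRows U f := by
    ext W
    refine exists_congr fun O => and_congr_right fun _ => ?_
    rw [← Matrix.ext_iff]
    refine forall_congr' fun i => ?_
    rw [Fin.forall_fin_succ]
    simp [U, f, Matrix.mul_apply]
  rw [hset]
  refine le_trans ?_ (choose_mul_coverNum_rotatedRows_le hU f hρ.2)
  gcongr
  omega
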